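/- arXiv:1705.05009 — 3 statements merged into one kernel-verified Lean document; each statement's English description precedes it below -/
import Mathlib

section
/- For θ = 1/4, the symbolic dynamics does not depend on σ in the interval (0,1): for all σ, σ' ∈ (0,1), the languages coincide, L(T_{1/4,σ}) = L(T_{1/4,σ'}). -/
/-- The piecewise rotation `T_{θ,σ}`:
`T_{θ,σ}(z) = e^{2πiθ}(z+σ+1)` if `Im z > 0` and `e^{2πiθ}(z+σ-1)` if `Im z < 0`
(points of the real axis are excluded from the dynamics). -/
noncomputable def pwRot (θ σ : ℝ) (z : ℂ) : ℂ :=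
  if 0 < z.im then Complex.exp (2 * Real.pi * θ * Complex.I) * (z + σ + 1)
  else Complex.exp (2 * Real.pi * θ * Complex.I) * (z + σ - 1)

/-- `z` has a well-defined orbit: it never hits the real axis. -/
def goodOrbit (θ σ : ℝ) (z : ℂ) : Prop := ∀ n : ℕ, ((pwRot θ σ)^[n] z).im ≠ 0

/-- The itinerary of `z`, with letters `1` and `2`. -/
noncomputable def itin (θ σ : ℝ) (z : ℂ) (n : ℕ) : ℕ :=
  if 0 < ((pwRot θ σ)^[n] z).im then 1 else 2

/-- The language of the piecewise rotation: finite words over `{1,2}` occurring as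
factors of itineraries of points with well-defined orbit. -/
def lang (θ σ : ℝ) : Set (List ℕ) :=
  {w | ∃ z : ℂ, goodOrbit θ σ z ∧ ∃ i : ℕ,
      w = (List.range w.length).map fun k => itin θ σ z (i + k)}

/-- The `2`-periodic interpolation which fixes `2ℤ` and carries `σ + 1 + 2ℤ` to `τ + 1 + 2ℤ`. -/
noncomputable def interp (σ τ y : ℝ) : ℝ :=
  if y - 2 * ⌊y / 2⌋ ≤ σ + 1 then 2 * ⌊y / 2⌋ + (y - 2 * ⌊y / 2⌋) * ((τ + 1) / (σ + 1))
  else 2 * ⌊y / 2⌋ + 2 - (2 + 2 * ⌊y / 2⌋ - y) * ((1 - τ) / (1 - σ))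

lemma floor_half_eq {y : ℝ} (m : ℤ) (h : 2 * (m : ℝ) ≤ y) (h' : y < 2 * m + 2) :
    ⌊y / 2⌋ = m := by
  rw [Int.floor_eq_iff]
  constructor <;> linarith

lemma interp_of_le {σ τ y : ℝ} (hσ : σ < 1) (m : ℤ) (h : 2 * (m : ℝ) ≤ y)
    (h' : y ≤ 2 * m + (σ + 1)) :
    interp σ τ y = 2 * m + (y - 2 * m) * ((τ + 1) / (σ + 1)) := by
  rw [interp, floor_half_eq m h (by linarith), if_pos (by linarith)]

lemma interp_of_gt {σ τ y : ℝ} (hσ : -1 < σ) (m : ℤ) (h : 2 * (m : ℝ) + (σ + 1) < y)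
    (h' : y < 2 * m + 2) :
    interp σ τ y = 2 * m + 2 - (2 + 2 * m - y) * ((1 - τ) / (1 - σ)) := by
  rw [interp, floor_half_eq m (by linarith) h', if_neg (by linarith)]

/-- Case distinction on the position of `y` relative to `2ℤ` and `σ + 1 + 2ℤ`. -/
lemma exists_int_le_or_gt (σ y : ℝ) :
    ∃ m : ℤ, (2 * (m : ℝ) ≤ y ∧ y ≤ 2 * m + (σ + 1)) ∨
      (2 * (m : ℝ) + (σ + 1) < y ∧ y < 2 * m + 2) := by
  have h := Int.floor_le (y / 2)
  have h' := Int.lt_floor_add_one (y / 2)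
  refine ⟨⌊y / 2⌋, ?_⟩
  rcases le_or_gt y (2 * ⌊y / 2⌋ + (σ + 1)) with hy | hy
  · exact Or.inl ⟨by linarith, hy⟩
  · exact Or.inr ⟨hy, by linarith⟩

lemma interp_add_one_sub {σ τ : ℝ} (hσ : -1 < σ) (hσ' : σ < 1) (k : ℤ) (y : ℝ) :
    interp σ τ (σ + 1 - y + 2 * k) = τ + 1 - interp σ τ y + 2 * k := by
  have h1 : σ + 1 ≠ 0 := by linarith
  have h2 : 1 - σ ≠ 0 := by linarith
  obtain ⟨m, ⟨h, h'⟩ | ⟨h, h'⟩⟩ := exists_int_le_or_gt σ y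
  · rw [interp_of_le hσ' m h h', interp_of_le hσ' (k - m) (by push_cast; linarith)
      (by push_cast; linarith)]
    push_cast
    field_simp
    ring
  · rw [interp_of_gt hσ m h h', interp_of_gt hσ (k - m - 1) (by push_cast; linarith)
      (by push_cast; linarith)]
    push_cast
    field_simp
    ring

lemma interp_pos {σ τ y : ℝ} (hσ : -1 < σ) (hσ' : σ < 1) (hτ : -1 < τ) (hτ' : τ < 1)
    (hy : 0 < y) : 0 < interp σ τ y := by
  have h1 : 0 < (τ + 1) / (σ + 1) := div_pos (by linarith) (by linarith)
  have h2 : 0 < (1 - τ) / (1 - σ) := div_pos (by linarith) (by linarith)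
  obtain ⟨m, ⟨h, h'⟩ | ⟨h, h'⟩⟩ := exists_int_le_or_gt σ y
  · have hm : (0 : ℝ) ≤ m := by
      have : (-1 : ℝ) < m := by linarith
      exact_mod_cast Int.add_one_le_of_lt (by exact_mod_cast this : (-1 : ℤ) < m)
    rw [interp_of_le hσ' m h h']
    rcases hm.eq_or_lt with hm | hm
    · rw [← hm]
      have := mul_pos hy h1
      simpa using this
    · have := mul_nonneg (sub_nonneg.2 h) h1.le
      linarith
  · have hm : (0 : ℝ) ≤ m := by
      have : (-1 : ℝ) < m := by linarith
      exact_mod_cast Int.add_one_le_of_lt (by exact_mod_cast this : (-1 : ℤ) < m)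
    rw [interp_of_gt hσ m h h']
    have h3 : (2 + 2 * m - y) * ((1 - τ) / (1 - σ)) < (1 - σ) * ((1 - τ) / (1 - σ)) :=
      mul_lt_mul_of_pos_right (by linarith) h2
    rw [mul_div_cancel₀ _ (by linarith : 1 - σ ≠ 0)] at h3
    linarith

lemma interp_neg {σ τ y : ℝ} (hσ : -1 < σ) (hσ' : σ < 1) (hτ : -1 < τ) (hτ' : τ < 1)
    (hy : y < 0) : interp σ τ y < 0 := by
  have h1 : 0 < (τ + 1) / (σ + 1) := div_pos (by linarith) (by linarith)
  have h2 : 0 < (1 - τ) / (1 - σ) := div_pos (by linarith) (by linarith)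
  obtain ⟨m, ⟨h, h'⟩ | ⟨h, h'⟩⟩ := exists_int_le_or_gt σ y
  · have hm : (m : ℝ) ≤ -1 := by
      have : (m : ℝ) < 0 := by linarith
      exact_mod_cast Int.le_sub_one_of_lt (by exact_mod_cast this : m < (0 : ℤ))
    rw [interp_of_le hσ' m h h']
    have h3 : (y - 2 * m) * ((τ + 1) / (σ + 1)) ≤ (σ + 1) * ((τ + 1) / (σ + 1)) :=
      mul_le_mul_of_nonneg_right (by linarith) h1.le
    rw [mul_div_cancel₀ _ (by linarith : σ + 1 ≠ 0)] at h3
    linarith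
  · have hm : (m : ℝ) ≤ -1 := by
      have : (m : ℝ) < 0 := by linarith
      exact_mod_cast Int.le_sub_one_of_lt (by exact_mod_cast this : m < (0 : ℤ))
    rw [interp_of_gt hσ m h h']
    have := mul_pos (by linarith : 0 < 2 + 2 * m - y) h2
    linarith

lemma interp_zero {σ τ : ℝ} (hσ : -1 < σ) (hσ' : σ < 1) : interp σ τ 0 = 0 := by
  rw [interp_of_le hσ' 0 (by simp) (by simp; linarith)]
  simp

lemma interp_pos_iff {σ τ y : ℝ} (hσ : -1 < σ) (hσ' : σ < 1) (hτ : -1 < τ) (hτ' : τ < 1) :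
    0 < interp σ τ y ↔ 0 < y := by
  rcases lt_trichotomy y 0 with hy | rfl | hy
  · have := interp_neg hσ hσ' hτ hτ' hy
    constructor <;> intro <;> linarith
  · rw [interp_zero hσ hσ']
  · have := interp_pos hσ hσ' hτ hτ' hy
    constructor <;> intro <;> assumption

lemma interp_ne_zero {σ τ y : ℝ} (hσ : -1 < σ) (hσ' : σ < 1) (hτ : -1 < τ) (hτ' : τ < 1)
    (hy : y ≠ 0) : interp σ τ y ≠ 0 := by
  rcases lt_or_gt_of_ne hy with hy | hy
  · exact (interp_neg hσ hσ' hτ hτ' hy).ne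
  · exact (interp_pos hσ hσ' hτ hτ' hy).ne'

/-- The map of the plane conjugating `pwRot (1/4) σ` to `pwRot (1/4) τ`. -/
noncomputable def planeInterp (σ τ : ℝ) (z : ℂ) : ℂ :=
  ⟨-interp σ τ (-z.re), interp σ τ z.im⟩

lemma pwRot_quarter (σ : ℝ) (z : ℂ) :
    pwRot (1/4) σ z = ⟨-z.im, if 0 < z.im then z.re + σ + 1 else z.re + σ - 1⟩ := by
  have h : Complex.exp (2 * Real.pi * (1/4 : ℝ) * Complex.I) = Complex.I := by
    rw [show 2 * (Real.pi : ℂ) * (1/4 : ℝ) * Complex.I = Real.pi / 2 * Complex.I by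
      push_cast; ring, Complex.exp_pi_div_two_mul_I]
  rw [pwRot, h]
  split_ifs <;> apply Complex.ext <;> simp

lemma semiconj_planeInterp {σ τ : ℝ} (hσ : -1 < σ) (hσ' : σ < 1) (hτ : -1 < τ) (hτ' : τ < 1) :
    Function.Semiconj (planeInterp σ τ) (pwRot (1/4) σ) (pwRot (1/4) τ) := by
  intro z
  rw [pwRot_quarter, pwRot_quarter]
  simp only [planeInterp, interp_pos_iff hσ hσ' hτ hτ', neg_neg]
  congr 1
  split_ifs
  · have := interp_add_one_sub (τ := τ) hσ hσ' 0 (-z.re)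
    push_cast at this
    rw [show z.re + σ + 1 = σ + 1 - -z.re + 2 * 0 by ring, this]
    ring
  · have := interp_add_one_sub (τ := τ) hσ hσ' (-1) (-z.re)
    push_cast at this
    rw [show z.re + σ - 1 = σ + 1 - -z.re + 2 * -1 by ring, this]
    ring

lemma lang_quarter_subset {σ τ : ℝ} (hσ : -1 < σ) (hσ' : σ < 1) (hτ : -1 < τ) (hτ' : τ < 1) :
    lang (1/4) σ ⊆ lang (1/4) τ := by
  rintro w ⟨z, hz, i, hw⟩
  have key (n : ℕ) : (pwRot (1/4) τ)^[n] (planeInterp σ τ z) =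
      planeInterp σ τ ((pwRot (1/4) σ)^[n] z) :=
    (((semiconj_planeInterp hσ hσ' hτ hτ').iterate_right n) z).symm
  have h_itin (n : ℕ) : itin (1/4) τ (planeInterp σ τ z) n = itin (1/4) σ z n := by
    rw [itin, itin, key]
    simp only [planeInterp, interp_pos_iff hσ hσ' hτ hτ']
  refine ⟨planeInterp σ τ z, fun n => ?_, i, ?_⟩
  · rw [key]
    exact interp_ne_zero hσ hσ' hτ hτ' (hz n)
  · simpa only [h_itin] using hw

/-- For `θ = 1/4`, the symbolic dynamics does not depend on `σ ∈ (0,1)`: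
the languages coincide. -/
theorem stmt_8 (σ σ' : ℝ) (h1 : 0 < σ) (h2 : σ < 1) (h1' : 0 < σ') (h2' : σ' < 1) :
    lang (1/4) σ = lang (1/4) σ' := by
  exact Set.Subset.antisymm
    (lang_quarter_subset (by linarith) h2 (by linarith) h2')
    (lang_quarter_subset (by linarith) h2' (by linarith) h2)
end

section
/- Let θ = 1/3 and σ > 1. Then every point z ∈ ℂ with well-defined orbit under T_{1/3,σ} is periodic: there exists n ≥ 1 with T_{1/3,σ}^n z = z. (The plane decomposes into periodic cells which are equilateral triangles and hexagons.) -/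
/-- The sign of `x`, with value `-1` at `0`. -/
noncomputable def stepSign (x : ℝ) : ℤ := if 0 < x then 1 else -1

/-- The number of steps of length `2` needed to move `x` into the positive half-line. -/
noncomputable def depth (x : ℝ) : ℤ := if 0 < x then 0 else 1 + ⌊-x / 2⌋

/-- `1` if both arguments are nonpositive, `0` otherwise. -/
noncomputable def bothNonpos (x y : ℝ) : ℤ := if 0 < x ∨ 0 < y then 0 else 1

theorem depth_nonneg (x : ℝ) : 0 ≤ depth x := by
  unfold depth
  split_ifs with h
  · exact le_rfl
  · have : 0 ≤ ⌊-x / 2⌋ := Int.floor_nonneg.2 (by linarith)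
    lia

theorem neg_two_mul_depth_le (x : ℝ) : -2 * (depth x : ℝ) ≤ x := by
  unfold depth
  split_ifs with h
  · simpa using h.le
  · have := Int.lt_floor_add_one (-x / 2)
    push_cast
    linarith

theorem depth_of_pos {x : ℝ} (h : 0 < x) : depth x = 0 := if_pos h

theorem depth_add_two (x : ℝ) : depth (x + 2) = depth x - if 0 < x then 0 else 1 := by
  by_cases h : 0 < x
  · simp [h, depth_of_pos, show 0 < x + 2 by linarith]
  · by_cases h2 : 0 < x + 2
    · have : ⌊-x / 2⌋ = 0 := Int.floor_eq_zero_iff.2 ⟨by linarith, by linarith⟩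
      simp [depth, h, h2, this]
    · have : -(x + 2) / 2 = -x / 2 - 1 := by ring
      rw [depth, depth, if_neg h, if_neg h2, if_neg h, this, Int.floor_sub_one]
      ring

theorem bothNonpos_mem (x y : ℝ) : bothNonpos x y = 0 ∨ bothNonpos x y = 1 := by
  unfold bothNonpos
  split_ifs <;> simp

theorem stepSign_mem (x : ℝ) : stepSign x = 1 ∨ stepSign x = -1 := by
  unfold stepSign
  split_ifs <;> simp

/-- The conserved quantity of the recurrence `x + y + z = σ + stepSign y`. -/
noncomputable def windowDepth (x y z : ℝ) : ℤ :=
  depth x + depth y + depth z - bothNonpos x y - bothNonpos y z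

theorem windowDepth_shift {σ w x y z : ℝ} (hσ : 1 < σ) (hx : w + x + y = σ + stepSign x)
    (hy : x + y + z = σ + stepSign y) : windowDepth x y z = windowDepth w x y := by
  unfold windowDepth
  suffices depth z - bothNonpos y z = depth w - bothNonpos w x by lia
  unfold stepSign at hx hy
  by_cases h1 : 0 < x <;> by_cases h2 : 0 < y <;> simp only [h1, h2, if_true, if_false] at hx hy <;>
    push_cast at hx hy
  · have : z = w := by linarith
    simp [bothNonpos, h1, h2, this]
  · have : w = z + 2 := by linarith
    simp [bothNonpos, h1, h2, this, depth_add_two]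
  · have : z = w + 2 := by linarith
    simp [bothNonpos, h1, h2, this, depth_add_two]
  · have hw : 0 < w := by linarith
    have hz : 0 < z := by linarith
    simp [bothNonpos, hw, hz, depth_of_pos]

theorem exists_abs_le_of_recurrence {σ : ℝ} (hσ : 1 < σ) {x : ℕ → ℝ}
    (hx : ∀ n, x n + x (n + 1) + x (n + 2) = σ + stepSign (x (n + 1))) :
    ∃ K : ℝ, ∀ n, |x n| ≤ K := by
  have hconst : ∀ n, windowDepth (x n) (x (n + 1)) (x (n + 2)) =
      windowDepth (x 0) (x 1) (x 2) := by
    intro n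
    induction n with
    | zero => rfl
    | succ n ih => rw [← ih]; exact windowDepth_shift hσ (hx n) (hx (n + 1))
  set c := windowDepth (x 0) (x 1) (x 2)
  have hlow : ∀ n, -2 * ((c : ℝ) + 2) ≤ x n := by
    intro n
    have h := hconst n
    unfold windowDepth at h
    have h1 := depth_nonneg (x (n + 1))
    have h2 := depth_nonneg (x (n + 2))
    have h3 := bothNonpos_mem (x n) (x (n + 1))
    have h4 := bothNonpos_mem (x (n + 1)) (x (n + 2))
    have h5 : depth (x n) ≤ c + 2 := by lia
    have h6 : (depth (x n) : ℝ) ≤ c + 2 := by exact_mod_cast h5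
    linarith [neg_two_mul_depth_le (x n)]
  refine ⟨|σ + 1 + 4 * (c + 2)| + |2 * ((c : ℝ) + 2)|, fun n => ?_⟩
  have hs : (stepSign (x (n + 1)) : ℝ) ≤ 1 := by
    rcases stepSign_mem (x (n + 1)) with h | h <;> norm_num [h]
  have := hx n
  have := hlow n
  have := hlow (n + 1)
  have := hlow (n + 2)
  rw [abs_le]
  constructor <;> linarith [le_abs_self (σ + 1 + 4 * (c + 2)), le_abs_self (2 * ((c : ℝ) + 2)),
    abs_nonneg (σ + 1 + 4 * (c + 2)), abs_nonneg (2 * ((c : ℝ) + 2))]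

theorem exists_int_of_recurrence {σ : ℝ} {x : ℕ → ℝ}
    (hx : ∀ n, x n + x (n + 1) + x (n + 2) = σ + stepSign (x (n + 1))) (m n : ℕ) :
    ∃ k : ℤ, x (3 * n + m) = x m + k := by
  induction n with
  | zero => exact ⟨0, by simp⟩
  | succ n ih =>
    obtain ⟨k, hk⟩ := ih
    refine ⟨k + stepSign (x (3 * n + m + 2)) - stepSign (x (3 * n + m + 1)), ?_⟩
    have h0 := hx (3 * n + m)
    have h1 := hx (3 * n + m + 1)
    rw [show 3 * (n + 1) + m = 3 * n + m + 1 + 2 by ring]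
    push_cast
    simp only [add_assoc, Nat.reduceAdd] at *
    linarith

theorem recurrence_cancel {σ : ℝ} {x : ℕ → ℝ}
    (hx : ∀ n, x n + x (n + 1) + x (n + 2) = σ + stepSign (x (n + 1))) (p i : ℕ)
    (h0 : x (p + i) = x i) (h1 : x (p + i + 1) = x (i + 1)) :
    x p = x 0 ∧ x (p + 1) = x 1 := by
  induction i with
  | zero => exact ⟨h0, h1⟩
  | succ i ih =>
    refine ih ?_ h0
    have e0 := hx i
    have e1 := hx (p + i)
    simp only [← add_assoc] at h0
    rw [h0, show x (p + i + 2) = x (i + 2) from h1] at e1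
    linarith

theorem exists_period_of_recurrence {σ : ℝ} (hσ : 1 < σ) {x : ℕ → ℝ}
    (hx : ∀ n, x n + x (n + 1) + x (n + 2) = σ + stepSign (x (n + 1))) :
    ∃ p, 1 ≤ p ∧ x p = x 0 ∧ x (p + 1) = x 1 := by
  obtain ⟨K, hK⟩ := exists_abs_le_of_recurrence hσ hx
  choose k hk using exists_int_of_recurrence hx
  have hbound : ∀ m n, k m n ∈ Set.Icc (-⌈2 * K⌉) ⌈2 * K⌉ := by
    intro m n
    have h1 := abs_le.1 (hK m)
    have h2 := abs_le.1 (hK (3 * n + m))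
    have h3 := hk m n
    have h4 := Int.le_ceil (2 * K)
    constructor
    · have : ((-⌈2 * K⌉ : ℤ) : ℝ) ≤ k m n := by push_cast; linarith
      exact_mod_cast this
    · have : (k m n : ℝ) ≤ (⌈2 * K⌉ : ℤ) := by linarith
      exact_mod_cast this
  let f : ℕ → Set.Icc (-⌈2 * K⌉) ⌈2 * K⌉ × Set.Icc (-⌈2 * K⌉) ⌈2 * K⌉ :=
    fun n => (⟨k 0 n, hbound 0 n⟩, ⟨k 1 n, hbound 1 n⟩)
  obtain ⟨i, j, hij, hf⟩ := Finite.exists_ne_map_eq_of_infinite f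
  wlog hlt : i < j generalizing i j
  · exact this j i hij.symm hf.symm (by lia)
  obtain ⟨e0, e1⟩ : k 0 i = k 0 j ∧ k 1 i = k 1 j := by simpa [f] using hf
  have hj : 3 * (j - i) + 3 * i = 3 * j := by lia
  refine ⟨3 * (j - i), by lia, recurrence_cancel hx _ (3 * i) ?_ ?_⟩ <;> rw [hj]
  · have := hk 0 i
    have := hk 0 j
    simp_all
  · rw [hk 1 i, hk 1 j, e1]

theorem exp_two_pi_div_three :
    Complex.exp (2 * Real.pi * ((1 / 3 : ℝ) : ℂ) * Complex.I) = ⟨-1 / 2, √3 / 2⟩ := by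
  have h : (2 * Real.pi * ((1 / 3 : ℝ) : ℂ) * Complex.I) =
      ((Real.pi - Real.pi / 3 : ℝ) : ℂ) * Complex.I := by push_cast; ring
  rw [h]
  apply Complex.ext
  · rw [Complex.exp_ofReal_mul_I_re, Real.cos_pi_sub, Real.cos_pi_div_three]; norm_num
  · rw [Complex.exp_ofReal_mul_I_im, Real.sin_pi_sub, Real.sin_pi_div_three]

/-- The imaginary part in units of the height of the unit equilateral triangle. -/
noncomputable def height (z : ℂ) : ℝ := 2 / √3 * z.im

theorem pwRot_third (σ : ℝ) (z : ℂ) :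
    pwRot (1 / 3) σ z = ⟨-1 / 2, √3 / 2⟩ * (z + σ + stepSign (height z)) := by
  have h : 0 < height z ↔ 0 < z.im := mul_pos_iff_of_pos_left (by positivity)
  unfold pwRot stepSign
  rw [exp_two_pi_div_three]
  simp only [h]
  split_ifs <;> push_cast <;> ring

theorem pwRot_third_re (σ : ℝ) (z : ℂ) : (pwRot (1 / 3) σ z).re =
    -1 / 2 * (z.re + σ + stepSign (height z)) - √3 / 2 * z.im := by
  rw [pwRot_third]
  simp

theorem pwRot_third_im (σ : ℝ) (z : ℂ) : (pwRot (1 / 3) σ z).im =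
    -1 / 2 * z.im + √3 / 2 * (z.re + σ + stepSign (height z)) := by
  rw [pwRot_third]
  simp

theorem height_recurrence (σ : ℝ) (z : ℂ) :
    height z + height (pwRot (1 / 3) σ z) + height (pwRot (1 / 3) σ (pwRot (1 / 3) σ z)) =
      σ + stepSign (height (pwRot (1 / 3) σ z)) := by
  have h3 : √3 ^ 2 = 3 := Real.sq_sqrt (by norm_num)
  have h : z.im + (pwRot (1 / 3) σ z).im + (pwRot (1 / 3) σ (pwRot (1 / 3) σ z)).im =
      √3 / 2 * (σ + stepSign (height (pwRot (1 / 3) σ z))) := by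
    rw [pwRot_third_im σ (pwRot (1 / 3) σ z), pwRot_third_re, pwRot_third_im]
    linear_combination (-z.im / 4) * h3
  have h4 : √3 ≠ 0 := by positivity
  calc _ = 2 / √3 * (z.im + (pwRot (1 / 3) σ z).im +
        (pwRot (1 / 3) σ (pwRot (1 / 3) σ z)).im) := by unfold height; ring
    _ = _ := by rw [h]; field_simp

theorem eq_of_height_eq {σ : ℝ} {z w : ℂ} (h0 : height z = height w)
    (h1 : height (pwRot (1 / 3) σ z) = height (pwRot (1 / 3) σ w)) : z = w := by
  have h2 : (2 / √3) ≠ 0 := by positivity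
  have him : z.im = w.im := mul_left_cancel₀ h2 h0
  have him' := mul_left_cancel₀ h2 h1
  rw [pwRot_third_im, pwRot_third_im, h0, him] at him'
  have h3 : √3 / 2 ≠ 0 := by positivity
  have := mul_left_cancel₀ h3 (add_left_cancel him')
  exact Complex.ext (by linarith) him

/-- For `θ = 1/3` and `σ > 1`, every point with well-defined orbit is periodic. -/
theorem stmt_14 (σ : ℝ) (hσ : 1 < σ) (z : ℂ) (hz : goodOrbit (1/3) σ z) :
    ∃ n : ℕ, 1 ≤ n ∧ (pwRot (1/3) σ)^[n] z = z := by
  obtain ⟨p, hp, h0, h1⟩ := exists_period_of_recurrence (σ := σ) hσ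
    (x := fun n => height ((pwRot (1 / 3) σ)^[n] z)) (fun n => by
      simp only [Function.iterate_succ_apply']
      exact height_recurrence σ _)
  refine ⟨p, hp, eq_of_height_eq (σ := σ) h0 ?_⟩
  simpa only [Function.iterate_succ_apply', Function.iterate_zero_apply] using h1
end

section
/- For θ = 1/8 and σ = 1, for each k ∈ {4, 5, 6} there exists a point z ∈ ℂ with well-defined orbit under T_{1/8,1} whose itinerary is the periodic word (1 2⁴ 1^k)^ω (i.e. one letter 1, then four letters 2, then k letters 1, repeated), and which satisfies T_{1/8,1}^{5+k} z = z. -/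
open Function

/-- The point `a + bζ + cζ² + dζ³` of `ℂ`, where `ζ = e^{πi/4}`. -/
noncomputable def octPoint (a b c d : ℝ) : ℂ :=
  ⟨a + (b - d) * (√2 / 2), c + (b + d) * (√2 / 2)⟩

/-- `PwPath θ σ w z z'`: iterating the piecewise rotation from `z` reaches `z'` after
`w.length` steps, off the real axis, and reading the word `w`. -/
inductive PwPath (θ σ : ℝ) : List ℕ → ℂ → ℂ → Prop
  | nil (z : ℂ) : PwPath θ σ [] z z
  | upper {w : List ℕ} {z z' : ℂ} (hz : 0 < z.im) (h : PwPath θ σ w (pwRot θ σ z) z') :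
      PwPath θ σ (1 :: w) z z'
  | lower {w : List ℕ} {z z' : ℂ} (hz : z.im < 0) (h : PwPath θ σ w (pwRot θ σ z) z') :
      PwPath θ σ (2 :: w) z z'

namespace PwPath

variable {θ σ : ℝ} {w : List ℕ} {z z' : ℂ}

theorem iterate_length (h : PwPath θ σ w z z') : (pwRot θ σ)^[w.length] z = z' := by
  induction h with
  | nil z => rfl
  | upper _ _ ih => simpa using ih
  | lower _ _ ih => simpa using ih

theorem im_ne_zero (h : PwPath θ σ w z z') :
    ∀ i < w.length, ((pwRot θ σ)^[i] z).im ≠ 0 := by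
  induction h with
  | nil z => simp
  | upper hz _ ih =>
    rintro (_ | i) hi
    · exact hz.ne'
    · exact ih i (by simpa using hi)
  | lower hz _ ih =>
    rintro (_ | i) hi
    · exact hz.ne
    · exact ih i (by simpa using hi)

theorem itin_eq (h : PwPath θ σ w z z') :
    ∀ i < w.length, itin θ σ z i = w.getD i 0 := by
  induction h with
  | nil z => simp
  | upper hz _ ih =>
    rintro (_ | i) hi
    · exact if_pos hz
    · exact ih i (by simpa using hi)
  | lower hz _ ih =>
    rintro (_ | i) hi
    · exact if_neg hz.not_gt
    · exact ih i (by simpa using hi)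

theorem isPeriodicPt (h : PwPath θ σ w z z) : IsPeriodicPt (pwRot θ σ) w.length z :=
  h.iterate_length

theorem hasGoodOrbit (h : PwPath θ σ w z z) (hw : 0 < w.length) : goodOrbit θ σ z := by
  intro n
  rw [← h.isPeriodicPt.iterate_mod_apply n]
  exact h.im_ne_zero _ (Nat.mod_lt _ hw)

theorem itin_eq_mod (h : PwPath θ σ w z z) (hw : 0 < w.length) (n : ℕ) :
    itin θ σ z n = w.getD (n % w.length) 0 := by
  rw [← h.itin_eq _ (Nat.mod_lt _ hw), itin, itin, h.isPeriodicPt.iterate_mod_apply n]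

end PwPath

theorem exp_two_pi_eighth :
    Complex.exp (2 * Real.pi * ((1 / 8 : ℝ) : ℂ) * Complex.I) = ⟨√2 / 2, √2 / 2⟩ := by
  have h : (2 * Real.pi * ((1 / 8 : ℝ) : ℂ) * Complex.I) = ((Real.pi / 4 : ℝ) : ℂ) * Complex.I := by
    push_cast
    ring
  rw [h]
  apply Complex.ext
  · rw [Complex.exp_ofReal_mul_I_re, Real.cos_pi_div_four]
  · rw [Complex.exp_ofReal_mul_I_im, Real.sin_pi_div_four]

theorem exp_mul_octPoint (a b c d : ℝ) :
    Complex.exp (2 * Real.pi * ((1 / 8 : ℝ) : ℂ) * Complex.I) * octPoint a b c d =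
      octPoint (-d) a b c := by
  have h2 : √2 * √2 = (2 : ℝ) := Real.mul_self_sqrt (by norm_num)
  rw [exp_two_pi_eighth]
  apply Complex.ext <;> simp only [octPoint, Complex.mul_re, Complex.mul_im]
  · linear_combination (-d / 2) * h2
  · linear_combination (b / 2) * h2

theorem pwRot_octPoint_of_pos {a b c d : ℝ} (h : 0 < (octPoint a b c d).im) :
    pwRot (1 / 8) 1 (octPoint a b c d) = octPoint (-d) (a + 2) b c := by
  rw [pwRot, if_pos h, ← exp_mul_octPoint]
  congr 1
  apply Complex.ext <;> simp [octPoint]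
  ring

theorem pwRot_octPoint_of_neg {a b c d : ℝ} (h : (octPoint a b c d).im < 0) :
    pwRot (1 / 8) 1 (octPoint a b c d) = octPoint (-d) a b c := by
  rw [pwRot, if_neg h.not_gt, ← exp_mul_octPoint]
  congr 1
  simp

namespace PwPath

variable {w : List ℕ} {z : ℂ} {a b c d : ℝ}

theorem octPoint_upper (h : 0 < c + (b + d) * (√2 / 2))
    (hp : PwPath (1 / 8) 1 w (octPoint (-d) (a + 2) b c) z) :
    PwPath (1 / 8) 1 (1 :: w) (octPoint a b c d) z :=
  .upper h (by rwa [pwRot_octPoint_of_pos h])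

theorem octPoint_lower (h : c + (b + d) * (√2 / 2) < 0)
    (hp : PwPath (1 / 8) 1 w (octPoint (-d) a b c) z) :
    PwPath (1 / 8) 1 (2 :: w) (octPoint a b c d) z :=
  .lower h (by rwa [pwRot_octPoint_of_neg h])

theorem of_eq {θ σ : ℝ} {z z' : ℂ} (h : z = z') : PwPath θ σ [] z z' :=
  h ▸ .nil z

end PwPath

theorem exists_pwPath (k : ℕ) (hk : k ∈ ({4, 5, 6} : Set ℕ)) :
    ∃ z : ℂ, PwPath (1 / 8) 1 ([1] ++ List.replicate 4 2 ++ List.replicate k 1) z z := by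
  have hs : 1 < √2 := by
    rw [Real.lt_sqrt] <;> norm_num
  rcases hk with rfl | rfl | rfl
  · refine ⟨octPoint (-5) (-1) 1 3, ?_⟩
    refine .octPoint_upper ?_ <| .octPoint_lower ?_ <| .octPoint_lower ?_ <| .octPoint_lower ?_ <|
      .octPoint_lower ?_ <| .octPoint_upper ?_ <| .octPoint_upper ?_ <| .octPoint_upper ?_ <|
      .octPoint_upper ?_ <| .of_eq (by norm_num)
    all_goals linarith
  · refine ⟨octPoint (-3) (-1) 1 1, ?_⟩
    refine .octPoint_upper ?_ <| .octPoint_lower ?_ <| .octPoint_lower ?_ <| .octPoint_lower ?_ <|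
      .octPoint_lower ?_ <| .octPoint_upper ?_ <| .octPoint_upper ?_ <| .octPoint_upper ?_ <|
      .octPoint_upper ?_ <| .octPoint_upper ?_ <| .of_eq (by norm_num)
    all_goals linarith
  · refine ⟨octPoint (-3) 1 (-1) 1, ?_⟩
    refine .octPoint_upper ?_ <| .octPoint_lower ?_ <| .octPoint_lower ?_ <| .octPoint_lower ?_ <|
      .octPoint_lower ?_ <| .octPoint_upper ?_ <| .octPoint_upper ?_ <| .octPoint_upper ?_ <|
      .octPoint_upper ?_ <| .octPoint_upper ?_ <| .octPoint_upper ?_ <| .of_eq (by norm_num)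
    all_goals linarith


/-- For `θ = 1/8`, `σ = 1` and each `k ∈ {4,5,6}`, there is a point with well-defined
orbit whose itinerary is the periodic word `(1 2⁴ 1^k)^ω` and which is periodic of
period `5 + k`. -/
theorem stmt_17 (k : ℕ) (hk : k ∈ ({4, 5, 6} : Set ℕ)) :
    ∃ z : ℂ, goodOrbit (1/8) 1 z ∧
      (∀ n : ℕ, itin (1/8) 1 z n =
        ([1] ++ List.replicate 4 2 ++ List.replicate k 1).getD
          (n % ([1] ++ List.replicate 4 2 ++ List.replicate k 1).length) 0) ∧
      (pwRot (1/8) 1)^[5 + k] z = z := by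
  obtain ⟨z, hz⟩ := exists_pwPath k hk
  have hlen : ([1] ++ List.replicate 4 2 ++ List.replicate k 1).length = 5 + k := by
    simp
    omega
  refine ⟨z, hz.hasGoodOrbit (by simp), hz.itin_eq_mod (by simp), ?_⟩
  rw [← hlen]
  exact hz.iterate_length
end
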